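/- Adding 100 ballots of the form A≻B≻D≻C to the profile 100:A≻B≻C≻D, 3250:A≻C≻B≻D, 2250:B≻D≻A≻C, 2220:C≻A≻B≻D, 1089:D≻A≻B≻C, 1091:D≻C≻B≻A changes the 2-seat STV winner set from {A,B} to {A,C}. In the modified election of 10100 voters, quota is 3367; A is elected with 3450 votes; A's 83 surplus votes transfer proportionally (B gets 83·(200/3450), C gets 83·(3250/3450)); D is eliminated transferring 1089 to B and 1091 to C; C reaches 3389.19 ≥ 3367 while B has 3343.81 < 3367. This is a paradox of negative involvement: ballots ranking C last cause C to win. -/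

import Mathlib

section STV

variable {C : Type*} [DecidableEq C] [LinearOrder C]

/-- A weighted ballot: a ranking of candidates together with its current
(rational) weight. -/
abbrev WBallot (C : Type*) := List C × ℚ

/-- The highest-ranked candidate on a ballot who is still remaining (neither
elected nor eliminated). -/
def wtop (rem : Finset C) (b : WBallot C) : Option C := b.1.find? (· ∈ rem)

/-- The current vote total of candidate `c`: the total weight of the ballots
whose highest-ranked remaining candidate is `c`. -/
def wscore (ballots : List (WBallot C)) (rem : Finset C) (c : C) : ℚ :=
  ((ballots.filter (fun b => wtop rem b = some c)).map Prod.snd).sum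

/-- A remaining candidate with the largest current vote total (ties broken
deterministically by the linear order on `C`). -/
def argmaxScore (ballots : List (WBallot C)) (rem : Finset C) (h : rem.Nonempty) : C :=
  (rem.filter (fun c => ∀ d ∈ rem, wscore ballots rem d ≤ wscore ballots rem c)).min'
    (by
      obtain ⟨c, hc, hmax⟩ := rem.exists_max_image (wscore ballots rem) h
      exact ⟨c, Finset.mem_filter.mpr ⟨hc, hmax⟩⟩)

/-- A remaining candidate with the smallest current vote total (ties broken
deterministically by the linear order on `C`). -/
def argminScore (ballots : List (WBallot C)) (rem : Finset C) (h : rem.Nonempty) : C :=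
  (rem.filter (fun c => ∀ d ∈ rem, wscore ballots rem c ≤ wscore ballots rem d)).min'
    (by
      obtain ⟨c, hc, hmin⟩ := rem.exists_min_image (wscore ballots rem) h
      exact ⟨c, Finset.mem_filter.mpr ⟨hc, hmin⟩⟩)

theorem argmaxScore_mem (ballots : List (WBallot C)) (rem : Finset C) (h : rem.Nonempty) :
    argmaxScore ballots rem h ∈ rem :=
  Finset.filter_subset _ _ (Finset.min'_mem _ _)

theorem argminScore_mem (ballots : List (WBallot C)) (rem : Finset C) (h : rem.Nonempty) :
    argminScore ballots rem h ∈ rem :=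
  Finset.filter_subset _ _ (Finset.min'_mem _ _)

/-- Proportional surplus transfer: when candidate `c` is elected with vote total
`s ≥ q`, every ballot currently counting for `c` is rescaled by `(s - q)/s`, so
that exactly the surplus `s - q` is passed on to the next remaining candidates
on those ballots. -/
def transferSurplus (ballots : List (WBallot C)) (rem : Finset C) (c : C) (q : ℚ) :
    List (WBallot C) :=
  let s := wscore ballots rem c
  ballots.map (fun b => if wtop rem b = some c then (b.1, b.2 * ((s - q) / s)) else b)

/-- One run of STV with quota `q` and `S` seats: in each round, if some remaining
candidate reaches quota, the one with the largest vote total is elected and their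
surplus is transferred proportionally; otherwise the candidate with the fewest
votes is eliminated and their ballots transfer at full value.  The process stops
when `S` candidates are elected, or when the remaining candidates suffice only to
fill the open seats (in which case they are all seated). -/
def stvAux (S : ℕ) (q : ℚ) (ballots : List (WBallot C)) (rem elected : Finset C) :
    Finset C :=
  if h1 : S ≤ elected.card then elected
  else if h2 : rem.card + elected.card ≤ S then elected ∪ rem
  else
    have h : rem.Nonempty := Finset.card_pos.mp (by omega)
    if (rem.filter (fun c => q ≤ wscore ballots rem c)).Nonempty then
      let c := argmaxScore ballots rem h
      stvAux S q (transferSurplus ballots rem c q) (rem.erase c) (insert c elected)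
    else
      stvAux S q ballots (rem.erase (argminScore ballots rem h)) elected
termination_by rem.card
decreasing_by
  · exact Finset.card_erase_lt_of_mem (argmaxScore_mem _ _ _)
  · exact Finset.card_erase_lt_of_mem (argminScore_mem _ _ _)

/-- The STV winner set for a profile of ballots (each with weight 1) with `S`
seats and Droop quota `⌊V/(S+1)⌋ + 1`. -/
def stvWinners [Fintype C] (S : ℕ) (P : List (List C)) : Finset C :=
  stvAux S ((P.length / (S + 1) + 1 : ℕ) : ℚ) (P.map (fun r => (r, (1 : ℚ))))
    Finset.univ ∅

end STV

/-- Candidates `A, B, C, D` are `0, 1, 2, 3 : Fin 4`.  The original 10000-voter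
profile. -/
def P8 : List (List (Fin 4)) :=
  List.replicate 100 [0, 1, 2, 3] ++ List.replicate 3250 [0, 2, 1, 3] ++
  List.replicate 2250 [1, 3, 0, 2] ++ List.replicate 2220 [2, 0, 1, 3] ++
  List.replicate 1089 [3, 0, 1, 2] ++ List.replicate 1091 [3, 2, 1, 0]

/-- The profile after adding 100 ballots of the form `A≻B≻D≻C`. -/
def P8' : List (List (Fin 4)) := P8 ++ List.replicate 100 [0, 1, 3, 2]

section STVRounds

variable {C : Type*} [DecidableEq C]

/-- The ballot list in which each ballot of `L` is repeated with its multiplicity. -/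
def expandBallots (L : List (WBallot C × ℕ)) : List (WBallot C) :=
  L.flatMap fun p => List.replicate p.2 p.1

theorem wscore_append (l₁ l₂ : List (WBallot C)) (rem : Finset C) (c : C) :
    wscore (l₁ ++ l₂) rem c = wscore l₁ rem c + wscore l₂ rem c := by
  simp [wscore]

theorem wscore_replicate (n : ℕ) (b : WBallot C) (rem : Finset C) (c : C) :
    wscore (List.replicate n b) rem c = if wtop rem b = some c then n * b.2 else 0 := by
  by_cases h : wtop rem b = some c <;> simp [wscore, h]

theorem wscore_expandBallots (L : List (WBallot C × ℕ)) (rem : Finset C) (c : C) :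
    wscore (expandBallots L) rem c =
      (L.map fun p => if wtop rem p.1 = some c then (p.2 : ℚ) * p.1.2 else 0).sum := by
  induction L with
  | nil => simp [expandBallots, wscore]
  | cons p L ih =>
    rw [List.map_cons, List.sum_cons, ← ih, ← wscore_replicate, ← wscore_append]
    rfl

theorem transferSurplus_expandBallots (L : List (WBallot C × ℕ)) (rem : Finset C) (c : C)
    (q s : ℚ) (hs : wscore (expandBallots L) rem c = s) :
    transferSurplus (expandBallots L) rem c q =
      expandBallots (L.map fun p =>
        (if wtop rem p.1 = some c then (p.1.1, p.1.2 * ((s - q) / s)) else p.1, p.2)) := by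
  simp only [transferSurplus, hs]
  simp [expandBallots, List.map_flatMap, List.flatMap_map]

variable [LinearOrder C]

theorem argmaxScore_eq_of_forall_lt {ballots : List (WBallot C)} {rem : Finset C}
    (h : rem.Nonempty) {c : C} (hc : c ∈ rem)
    (hlt : ∀ d ∈ rem, d ≠ c → wscore ballots rem d < wscore ballots rem c) :
    argmaxScore ballots rem h = c := by
  by_contra hne
  have hmax : argmaxScore ballots rem h ∈
      rem.filter (fun c => ∀ d ∈ rem, wscore ballots rem d ≤ wscore ballots rem c) :=
    Finset.min'_mem _ _
  exact (hlt _ (argmaxScore_mem _ _ h) hne).not_ge ((Finset.mem_filter.mp hmax).2 c hc)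

theorem argminScore_eq_of_forall_lt {ballots : List (WBallot C)} {rem : Finset C}
    (h : rem.Nonempty) {c : C} (hc : c ∈ rem)
    (hlt : ∀ d ∈ rem, d ≠ c → wscore ballots rem c < wscore ballots rem d) :
    argminScore ballots rem h = c := by
  by_contra hne
  have hmin : argminScore ballots rem h ∈
      rem.filter (fun c => ∀ d ∈ rem, wscore ballots rem c ≤ wscore ballots rem d) :=
    Finset.min'_mem _ _
  exact (hlt _ (argminScore_mem _ _ h) hne).not_ge ((Finset.mem_filter.mp hmin).2 c hc)

theorem stvAux_of_le_card {S : ℕ} {q : ℚ} {ballots : List (WBallot C)} {rem elected : Finset C}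
    (h : S ≤ elected.card) : stvAux S q ballots rem elected = elected := by
  rw [stvAux, dif_pos h]

theorem stvAux_elect {S : ℕ} {q : ℚ} {ballots : List (WBallot C)} {rem elected : Finset C}
    (c : C) (h₁ : elected.card < S) (h₂ : S < rem.card + elected.card) (hc : c ∈ rem)
    (hq : q ≤ wscore ballots rem c)
    (hlt : ∀ d ∈ rem, d ≠ c → wscore ballots rem d < wscore ballots rem c) :
    stvAux S q ballots rem elected =
      stvAux S q (transferSurplus ballots rem c q) (rem.erase c) (insert c elected) := by
  rw [stvAux, dif_neg h₁.not_ge, dif_neg h₂.not_ge,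
    if_pos ⟨c, Finset.mem_filter.mpr ⟨hc, hq⟩⟩]
  simp only [argmaxScore_eq_of_forall_lt ⟨c, hc⟩ hc hlt]

theorem stvAux_eliminate {S : ℕ} {q : ℚ} {ballots : List (WBallot C)} {rem elected : Finset C}
    (c : C) (h₁ : elected.card < S) (h₂ : S < rem.card + elected.card) (hc : c ∈ rem)
    (hq : ∀ d ∈ rem, wscore ballots rem d < q)
    (hlt : ∀ d ∈ rem, d ≠ c → wscore ballots rem c < wscore ballots rem d) :
    stvAux S q ballots rem elected = stvAux S q ballots (rem.erase c) elected := by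
  rw [stvAux, dif_neg h₁.not_ge, dif_neg h₂.not_ge, if_neg]
  · simp only [argminScore_eq_of_forall_lt ⟨c, hc⟩ hc hlt]
  · rintro ⟨d, hd⟩
    obtain ⟨hd, hqd⟩ := Finset.mem_filter.mp hd
    exact (hq d hd).not_ge hqd

end STVRounds

/-- The ballots of `P8` with `n` added ballots `A≻B≻D≻C`, where the ballots ranking `A` first
have weight `w`. -/
def extendedP8 (w : ℚ) (n : ℕ) : List (WBallot (Fin 4) × ℕ) :=
  [(([0, 1, 2, 3], w), 100), (([0, 2, 1, 3], w), 3250), (([1, 3, 0, 2], 1), 2250),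
   (([2, 0, 1, 3], 1), 2220), (([3, 0, 1, 2], 1), 1089), (([3, 2, 1, 0], 1), 1091),
   (([0, 1, 3, 2], w), n)]

theorem wscore_extendedP8_univ (w : ℚ) (n : ℕ) (c : Fin 4) :
    wscore (expandBallots (extendedP8 w n)) Finset.univ c =
      ![(3350 + n) * w, 2250, 2220, 2180] c := by
  rw [wscore_expandBallots]
  fin_cases c <;> simp [extendedP8, wtop] <;> ring

theorem wscore_extendedP8_erase_zero (w : ℚ) (n : ℕ) (c : Fin 4) :
    wscore (expandBallots (extendedP8 w n)) {1, 2, 3} c =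
      ![0, 2250 + (100 + n) * w, 2220 + 3250 * w, 2180] c := by
  rw [wscore_expandBallots]
  fin_cases c <;> simp [extendedP8, wtop] <;> ring

theorem wscore_extendedP8_pair (w : ℚ) (n : ℕ) (c : Fin 4) :
    wscore (expandBallots (extendedP8 w n)) {1, 2} c =
      ![0, 3339 + (100 + n) * w, 3311 + 3250 * w, 0] c := by
  rw [wscore_expandBallots]
  fin_cases c <;> simp [extendedP8, wtop] <;> ring

theorem transferSurplus_extendedP8 (n : ℕ) (q : ℚ) :
    transferSurplus (expandBallots (extendedP8 1 n)) Finset.univ 0 q =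
      expandBallots (extendedP8 ((3350 + n - q) / (3350 + n)) n) := by
  rw [transferSurplus_expandBallots _ _ _ q (3350 + n) (by simp [wscore_extendedP8_univ])]
  simp [extendedP8, wtop]

/-- The first two rounds: `A` is elected and `D` is eliminated. -/
theorem stvAux_extendedP8 (n : ℕ) (q w : ℚ) (hw : w = (3350 + n - q) / (3350 + n))
    (hq : q ≤ 3350 + n) (hB : 2250 + (100 + n) * w < q) (hC : 2220 + 3250 * w < q)
    (hw0 : 0 ≤ w) :
    stvAux 2 q (expandBallots (extendedP8 1 n)) Finset.univ ∅ =
      stvAux 2 q (expandBallots (extendedP8 w n)) {1, 2} {0} := by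
  have hn : (0 : ℚ) ≤ n := n.cast_nonneg
  have hnw : 0 ≤ (100 + n) * w := by positivity
  rw [stvAux_elect 0 (by decide) (by decide) (by decide)
      (by simpa [wscore_extendedP8_univ] using hq)
      (by
        intro d _ hd
        rw [wscore_extendedP8_univ, wscore_extendedP8_univ]
        fin_cases d <;> simp at hd ⊢ <;> linarith),
    transferSurplus_extendedP8, ← hw,
    show (Finset.univ : Finset (Fin 4)).erase 0 = {1, 2, 3} by decide, insert_empty_eq,
    stvAux_eliminate 3 (by decide) (by decide) (by decide)
      (by
        intro d _
        rw [wscore_extendedP8_erase_zero]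
        fin_cases d <;> simp <;> linarith)
      (by
        intro d hd hd'
        rw [wscore_extendedP8_erase_zero, wscore_extendedP8_erase_zero]
        fin_cases d <;> simp at hd hd' ⊢ <;> linarith),
    show ({1, 2, 3} : Finset (Fin 4)).erase 3 = {1, 2} by decide]

theorem map_P8 : P8.map (fun r => (r, (1 : ℚ))) = expandBallots (extendedP8 1 0) := by
  simp only [P8, extendedP8, expandBallots, List.map_append, List.map_replicate,
    List.flatMap_cons, List.flatMap_nil, List.append_assoc, List.replicate_zero, List.append_nil]

theorem map_P8' : P8'.map (fun r => (r, (1 : ℚ))) = expandBallots (extendedP8 1 100) := by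
  simp only [P8', P8, extendedP8, expandBallots, List.map_append, List.map_replicate,
    List.flatMap_cons, List.flatMap_nil, List.append_assoc, List.append_nil]

theorem length_P8 : P8.length = 10000 := by
  simp only [P8, List.length_append, List.length_replicate]

theorem length_P8' : P8'.length = 10100 := by
  simp only [P8', length_P8, List.length_append, List.length_replicate]

theorem stvWinners_P8 : stvWinners 2 P8 = {0, 1} := by
  rw [stvWinners, length_P8, map_P8]
  norm_num only
  rw [stvAux_extendedP8 0 3334 (16 / 3350) (by norm_num) (by norm_num) (by norm_num)
      (by norm_num) (by norm_num),
    stvAux_elect 1 (by decide) (by decide) (by decide)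
      (by rw [wscore_extendedP8_pair]; norm_num)
      (by
        intro d hd hd'
        rw [wscore_extendedP8_pair, wscore_extendedP8_pair]
        fin_cases d <;> simp at hd hd' ⊢; norm_num),
    stvAux_of_le_card (by decide)]
  decide

theorem stvWinners_P8' : stvWinners 2 P8' = {0, 2} := by
  rw [stvWinners, length_P8', map_P8']
  norm_num only
  rw [stvAux_extendedP8 100 3367 (83 / 3450) (by norm_num) (by norm_num) (by norm_num)
      (by norm_num) (by norm_num),
    stvAux_elect 2 (by decide) (by decide) (by decide)
      (by rw [wscore_extendedP8_pair]; simp; norm_num)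
      (by
        intro d hd hd'
        rw [wscore_extendedP8_pair, wscore_extendedP8_pair]
        fin_cases d <;> simp at hd hd' ⊢; norm_num),
    stvAux_of_le_card (by decide)]
  decide

/-- Paradox of negative involvement in 2-seat STV: adding 100 ballots
`A≻B≻D≻C` (ranking `C` last) changes the winner set from `{A, B}` to `{A, C}`.
In the modified 10100-voter election the quota is 3367; `A` is elected with 3450
votes; `A`'s 83 surplus votes transfer proportionally (`B` gets `83·(200/3450)`,
`C` gets `83·(3250/3450)`); `D` is eliminated, transferring 1089 votes to `B`
and 1091 to `C`; `C` reaches `3389.19… ≥ 3367` while `B` has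
`3343.81… < 3367`. -/
theorem stv_negative_involvement_P8 :
    stvWinners 2 P8 = {0, 1} ∧
    P8'.length = 10100 ∧ (10100 / 3 + 1 : ℕ) = 3367 ∧
    wscore (P8'.map (fun r => (r, (1 : ℚ)))) Finset.univ 0 = 3450 ∧
    (3450 : ℚ) - 3367 = 83 ∧
    (3367 : ℚ) ≤ 2220 + 83 * (3250 / 3450) + 1091 ∧
    (2250 + 83 * (200 / 3450) + 1089 : ℚ) < 3367 ∧
    stvWinners 2 P8' = {0, 2} := by
  refine ⟨stvWinners_P8, length_P8', by norm_num, ?_, by norm_num, by norm_num, by norm_num,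
    stvWinners_P8'⟩
  rw [map_P8', wscore_extendedP8_univ]
  norm_num
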